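/- arXiv:1202.3422 — 7 statements merged into one kernel-verified Lean document; each statement's English description precedes it below -/
import Mathlib

section
/- Let r ≥ 2 and s ≥ 1 be integers and let a_1, …, a_r be nonnegative integers, not all zero. Let I be the ideal of the polynomial ring ℤ[x,y] generated by x^{s+1} and y·∏_{i=1}^r (y − a_i·x). If A and B are integers such that (A·x + B·y)^{s+1} ∈ I, then B = 0. -/
open MvPolynomial

/-- If `(A·x + B·y)^n` lies in the ideal generated by `x^n` and `y·∏ (y - aᵢ·x)`, then
`(A + B·b)^n` takes the same integer value at all roots `b` of `y·∏ (y - aᵢ)`, in any ring. -/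
theorem exists_intCast_eq_pow_of_mem_span {ι : Type*} [Fintype ι] {n : ℕ} {a : ι → ℕ} {A B : ℤ}
    (h : (C A * X 0 + C B * X 1) ^ n ∈
      Ideal.span {(X 0 : MvPolynomial (Fin 2) ℤ) ^ n,
        X 1 * ∏ i, (X 1 - C (a i : ℤ) * X 0)}) :
    ∃ c : ℤ, ∀ (R : Type) [CommRing R] (b : R), b * ∏ i, (b - (a i : R)) = 0 →
      ((A : R) + B * b) ^ n = c := by
  obtain ⟨P, Q, hPQ⟩ := Ideal.mem_span_pair.1 h
  refine ⟨constantCoeff P, fun R _ b hb => ?_⟩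
  let φ : MvPolynomial (Fin 2) ℤ →+* Polynomial R :=
    eval₂Hom (Int.castRingHom _) ![Polynomial.X, Polynomial.C b * Polynomial.X]
  have hφ0 : φ (X 0) = Polynomial.X := by simp [φ]
  have hφ1 : φ (X 1) = Polynomial.C b * Polynomial.X := by simp [φ]
  have hφC (z : ℤ) : φ (C z) = Polynomial.C (z : R) := by simp [φ]
  have hroot : φ (X 1 * ∏ i, (X 1 - C (a i : ℤ) * X 0)) = 0 := by
    have hfac (i : ι) : φ (X 1 - C (a i : ℤ) * X 0) =
        Polynomial.C (b - (a i : R)) * Polynomial.X := by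
      rw [map_sub, map_mul, hφ0, hφ1, hφC, Int.cast_natCast, Polynomial.C_sub, sub_mul]
    rw [map_mul, map_prod, hφ1, Finset.prod_congr rfl fun i _ => hfac i, Finset.prod_mul_distrib,
      ← map_prod, mul_mul_mul_comm, ← Polynomial.C_mul, hb, Polynomial.C_0, zero_mul]
  have hcoeff : (φ P).coeff 0 = (constantCoeff P : ℤ) := by
    have hhom : (Polynomial.constantCoeff.comp φ) =
        (Int.castRingHom R).comp constantCoeff := by
      apply MvPolynomial.ringHom_ext
      · intro z
        simp [φ]
      · intro i
        fin_cases i <;> simp [φ]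
    exact congrArg (fun f => f P) hhom
  have hlin : φ (C A * X 0 + C B * X 1) =
      Polynomial.C ((A : R) + B * b) * Polynomial.X := by
    rw [map_add, map_mul, map_mul, hφ0, hφ1, hφC, hφC, Polynomial.C_add, Polynomial.C_mul]
    ring
  have key := congrArg (fun p => (φ p).coeff n) hPQ
  simp only [map_add, map_mul φ P, map_mul φ Q, hroot, map_pow, hφ0, mul_zero, add_zero] at key
  rw [← map_add, hlin, mul_pow, ← Polynomial.C_pow,
    Polynomial.coeff_C_mul_X_pow, if_pos rfl, Polynomial.coeff_mul_X_pow', if_pos le_rfl,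
    Nat.sub_self, hcoeff] at key
  exact key.symm

/-- If a power of `A + B·y` has an integer value at `b + ε` in the dual numbers, then
its derivative vanishes at `b`. -/
theorem derivative_pow_eq_zero_of_dualNumber {s : ℕ} {A B b c : ℤ}
    (h : ((A : DualNumber ℤ) + (B : DualNumber ℤ) * ((b : DualNumber ℤ) + DualNumber.eps)) ^ (s + 1) =
      (c : DualNumber ℤ)) :
    (A + B * b) ^ s * B = 0 := by
  have hs : (s : ℤ) + 1 ≠ 0 := by positivity
  simpa [TrivSqZeroExt.snd_pow, hs] using congrArg TrivSqZeroExt.snd h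

/-- If `(A·x + B·y)^(s+1)` lies in the ideal generated by `x^(s+1)` and
`y·∏ (y - aᵢ·x)` in `ℤ[x,y]`, with `r ≥ 2`, `s ≥ 1`, the `aᵢ` nonnegative and
not all zero, then `B = 0`. -/
theorem stmt_0 (r s : ℕ) (hr : 2 ≤ r) (hs : 1 ≤ s) (a : Fin r → ℕ)
    (ha : ∃ i, a i ≠ 0) (A B : ℤ)
    (h : (C A * X 0 + C B * X 1) ^ (s + 1) ∈
      Ideal.span {(X 0 : MvPolynomial (Fin 2) ℤ) ^ (s + 1),
        X 1 * ∏ i : Fin r, (X 1 - C (a i : ℤ) * X 0)}) :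
    B = 0 := by
  by_contra hB
  obtain ⟨c, hc⟩ := exists_intCast_eq_pow_of_mem_span h
  have hzero : A ^ (s + 1) = c := by simpa using hc ℤ 0 (zero_mul _)
  have hval (i : Fin r) : (A + B * a i) ^ (s + 1) = c := by
    simpa using hc ℤ (a i)
      (mul_eq_zero_of_right _ (Finset.prod_eq_zero (Finset.mem_univ i) (sub_self _)))
  have hdouble {b : ℤ} (hb : ((b : DualNumber ℤ) + DualNumber.eps) *
      ∏ i, ((b : DualNumber ℤ) + DualNumber.eps - (a i : DualNumber ℤ)) = 0) :
      A + B * b = 0 := by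
    have := derivative_pow_eq_zero_of_dualNumber (hc (DualNumber ℤ) _ hb)
    exact eq_zero_of_pow_eq_zero ((mul_eq_zero.1 this).resolve_right hB)
  by_cases h0 : ∃ i, a i = 0
  · obtain ⟨i, hi⟩ := h0
    obtain ⟨j, hj⟩ := ha
    have hA : A = 0 := by
      have := hdouble (b := 0) (by
        rw [← Finset.mul_prod_erase _ _ (Finset.mem_univ i), ← mul_assoc]
        simp [hi])
      simpa using this
    have hj' := hval j
    rw [← hzero, hA, zero_add, zero_pow s.succ_ne_zero] at hj'
    exact mul_ne_zero hB (Nat.cast_ne_zero.2 hj) (eq_zero_of_pow_eq_zero hj')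
  · push Not at h0
    have hneg (i : Fin r) : A + B * a i = -A := by
      have habs : |A + B * a i| = |A| := by
        rw [← pow_left_inj₀ (abs_nonneg _) (abs_nonneg _) s.succ_ne_zero, ← abs_pow, ← abs_pow]
        exact congrArg abs ((hval i).trans hzero.symm)
      refine (abs_eq_abs.1 habs).resolve_left fun heq => ?_
      exact mul_ne_zero hB (Nat.cast_ne_zero.2 (h0 i)) (by linarith)
    let i : Fin r := ⟨0, by omega⟩
    let j : Fin r := ⟨1, by omega⟩
    have hij : j ≠ i := by simp [i, j]
    have haij : a j = a i := by
      have : B * a j = B * a i := by linarith [hneg i, hneg j]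
      exact_mod_cast mul_left_cancel₀ hB this
    have hd := hdouble (b := a i) (by
      rw [← Finset.mul_prod_erase _ _ (Finset.mem_univ i),
        ← Finset.mul_prod_erase _ _ (Finset.mem_erase.2 ⟨hij, Finset.mem_univ j⟩),
        haij, Int.cast_natCast, add_sub_cancel_left, ← mul_assoc DualNumber.eps,
        DualNumber.eps_mul_eps, zero_mul, mul_zero])
    exact mul_ne_zero hB (Nat.cast_ne_zero.2 (h0 i)) (by linarith [hneg i])
end

section
/- Fix integers r ≥ s ≥ 2. Let a = (a_1, …, a_r) and b = (b_1, …, b_r) be vectors of nonnegative integers with the a_i not all zero, and let C be a real number such that σ_i(C, C+a) = σ_i(0, b) for all integers i with 1 ≤ i ≤ s. Then −σ_1(a)/(r+1) ≤ C ≤ ((r−1)/r)·σ_1(a). -/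
/-- The `k`-th elementary symmetric polynomial of the tuple `v`. -/
def esymm {R : Type*} [CommSemiring R] {n : ℕ} (v : Fin n → R) (k : ℕ) : R :=
  ∑ S ∈ Finset.powersetCard k Finset.univ, ∏ j ∈ S, v j

/-- The square of a sum is the sum of squares plus twice the sum over unordered pairs. -/
theorem sum_sq_eq_sum_sq_add_two_mul_sum_powersetCard_two {R ι : Type*} [CommSemiring R]
    [DecidableEq ι] (s : Finset ι) (v : ι → R) :
    (∑ i ∈ s, v i) ^ 2 =
      ∑ i ∈ s, v i ^ 2 + 2 * ∑ S ∈ Finset.powersetCard 2 s, ∏ j ∈ S, v j := by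
  induction s using Finset.induction_on with
  | empty => simp [Finset.powersetCard_eq_empty.2 (show (∅ : Finset ι).card < 2 by simp)]
  | insert x s hx ih =>
    have hinj : Set.InjOn (insert x) (Finset.powersetCard 1 s : Set (Finset ι)) := by
      intro S hS T hT hST
      have hS' : x ∉ S := fun h => hx ((Finset.mem_powersetCard.1 hS).1 h)
      have hT' : x ∉ T := fun h => hx ((Finset.mem_powersetCard.1 hT).1 h)
      rw [← Finset.erase_insert hS', ← Finset.erase_insert hT', hST]
    have hdisj : Disjoint (Finset.powersetCard 2 s)
        ((Finset.powersetCard 1 s).image (insert x)) := by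
      rw [Finset.disjoint_left]
      intro S hS hS'
      obtain ⟨T, -, rfl⟩ := Finset.mem_image.1 hS'
      exact hx ((Finset.mem_powersetCard.1 hS).1 (Finset.mem_insert_self x T))
    have hpairs : ∑ S ∈ (Finset.powersetCard 1 s).image (insert x), ∏ j ∈ S, v j =
        v x * ∑ i ∈ s, v i := by
      rw [Finset.sum_image hinj, Finset.powersetCard_one, Finset.sum_map, Finset.mul_sum]
      refine Finset.sum_congr rfl fun i hi => ?_
      exact Finset.prod_pair fun h => hx (h ▸ hi)
    rw [Finset.powersetCard_succ_insert hx, Finset.sum_union hdisj, hpairs,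
      Finset.sum_insert hx, Finset.sum_insert hx, add_sq, ih]
    ring

theorem esymm_one {R : Type*} [CommSemiring R] {n : ℕ} (v : Fin n → R) :
    esymm v 1 = ∑ i, v i := by
  simp [esymm, Finset.powersetCard_one]

theorem sq_sum_eq_sum_sq_add_two_mul_esymm_two {R : Type*} [CommSemiring R] {n : ℕ}
    (v : Fin n → R) : (∑ i, v i) ^ 2 = ∑ i, v i ^ 2 + 2 * esymm v 2 :=
  sum_sq_eq_sum_sq_add_two_mul_sum_powersetCard_two Finset.univ v

/-- If `r ≥ s ≥ 2`, `a` is a nonzero nonnegative integer vector, `b` a nonnegative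
integer vector, and `C` a real number with `σᵢ(C, C+a) = σᵢ(0, b)` for `1 ≤ i ≤ s`,
then `−σ₁(a)/(r+1) ≤ C ≤ ((r−1)/r)·σ₁(a)`. -/
theorem stmt_2 (r s : ℕ) (hs : 2 ≤ s) (hsr : s ≤ r) (a b : Fin r → ℕ)
    (ha : ∃ i, a i ≠ 0) (C : ℝ)
    (h : ∀ i : ℕ, 1 ≤ i → i ≤ s →
      esymm (Fin.cons C (fun j => C + (a j : ℝ))) i =
        esymm (Fin.cons (0 : ℝ) (fun j => (b j : ℝ))) i) :
    -(∑ i, (a i : ℝ)) / (r + 1) ≤ C ∧ C ≤ (r - 1) / r * ∑ i, (a i : ℝ) := by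
  have h1 := h 1 le_rfl (by omega)
  have h2 := h 2 (by norm_num) hs
  have ea := sq_sum_eq_sum_sq_add_two_mul_esymm_two
    (Fin.cons C (fun j => C + (a j : ℝ)) : Fin (r + 1) → ℝ)
  have eb := sq_sum_eq_sum_sq_add_two_mul_esymm_two
    (Fin.cons 0 (fun j => (b j : ℝ)) : Fin (r + 1) → ℝ)
  rw [esymm_one, esymm_one] at h1
  rw [h1, h2, eb] at ea
  have hcs : (∑ i, (b i : ℝ)) ^ 2 ≤ r * ∑ i, (b i : ℝ) ^ 2 := by
    simpa using sq_sum_le_card_mul_sum_sq (s := Finset.univ) (f := fun i => (b i : ℝ))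
  have hQ : ∑ i, (a i : ℝ) ^ 2 ≤ (∑ i, (a i : ℝ)) ^ 2 :=
    Finset.sum_sq_le_sq_sum_of_nonneg fun i _ => Nat.cast_nonneg (a i)
  have hB : 0 ≤ ∑ i, (b i : ℝ) := by positivity
  have hA : 0 < ∑ i, (a i : ℝ) := by
    obtain ⟨i, hi⟩ := ha
    exact Finset.sum_pos' (fun j _ => Nat.cast_nonneg (a j))
      ⟨i, Finset.mem_univ i, by positivity⟩
  have hr : (2 : ℝ) ≤ r := by exact_mod_cast hs.trans hsr
  simp only [Fin.sum_univ_succ, Fin.cons_zero, Fin.cons_succ, add_sq, Finset.sum_add_distrib,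
    Finset.sum_const, Finset.card_univ, Fintype.card_fin, nsmul_eq_mul, ← Finset.mul_sum,
    zero_add] at h1 ea
  generalize ∑ i, (a i : ℝ) = A at *
  generalize ∑ i, (b i : ℝ) = B at *
  generalize ∑ i, (a i : ℝ) ^ 2 = Q at *
  generalize ∑ i, (b i : ℝ) ^ 2 = P at *
  have hlow : -A ≤ (r + 1) * C := by linarith
  have hP : P = (r + 1) * C ^ 2 + 2 * C * A + Q := by linarith
  have hBeq : B = (r + 1) * C + A := by linarith
  have hCA : 0 < C + A := by nlinarith
  have hfac : ((r + 1) * C - (r - 1) * A) * (C + A) ≤ 0 := by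
    have := mul_le_mul_of_nonneg_left hQ (by linarith : (0 : ℝ) ≤ r)
    rw [hP, hBeq] at hcs
    linarith
  have hup : (r + 1) * C ≤ (r - 1) * A := by
    linarith [nonpos_of_mul_nonpos_left hfac hCA]
  constructor
  · rw [div_le_iff₀ (by linarith)]
    linarith
  · rw [div_mul_eq_mul_div, le_div_iff₀ (by linarith)]
    rcases le_total 0 C with hC | hC
    · linarith
    · nlinarith
end

section
/- Fix an integer C ≥ 1, an integer r ≥ 1, and a vector a = (a_1, …, a_r) of nonnegative integers. Suppose that σ_2(0, b) ≤ σ_2(C, C+a) for every integer vector b = (b_1, …, b_r) with σ_1(0, b) = σ_1(C, C+a). Then for every integer n ≥ 1 and every integer vector b = (b_1, …, b_r) with σ_1(0, b) = σ_1(C+n, C+n+a), one has the strict inequality σ_2(0, b) < σ_2(C+n, C+n+a). -/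
theorem esymm_eq_eval {R : Type*} [CommSemiring R] {n : ℕ} (v : Fin n → R) (k : ℕ) :
    esymm v k = MvPolynomial.eval v (MvPolynomial.esymm (Fin n) R k) := by
  simp [esymm, MvPolynomial.esymm]

/-- Newton's identity in degree two. -/
theorem two_mul_esymm_two {R : Type*} [CommRing R] {n : ℕ} (v : Fin n → R) :
    2 * esymm v 2 = (∑ i, v i) ^ 2 - ∑ i, v i ^ 2 := by
  have h := congrArg (MvPolynomial.eval v) (MvPolynomial.mul_esymm_eq_sum (Fin n) R 2)
  have hs : (Finset.HasAntidiagonal.antidiagonal 2).filter (fun x : ℕ × ℕ => x.1 < 2) =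
      {(0, 2), (1, 1)} := by
    decide
  rw [hs] at h
  simp [MvPolynomial.esymm_one, MvPolynomial.psum] at h
  rw [esymm_eq_eval, h]
  ring

theorem esymm_two_lt_of_esymm_two_le {r : ℕ} {C : ℤ} (hC : 0 ≤ C) (a : Fin r → ℕ)
    (h : ∀ b : Fin r → ℤ,
      esymm (Fin.cons (0 : ℤ) b) 1 = esymm (Fin.cons C (fun j => C + (a j : ℤ))) 1 →
      esymm (Fin.cons (0 : ℤ) b) 2 ≤ esymm (Fin.cons C (fun j => C + (a j : ℤ))) 2)
    (b : Fin r → ℤ)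
    (hb : esymm (Fin.cons (0 : ℤ) b) 1 =
      esymm (Fin.cons (C + 1) (fun j => C + 1 + (a j : ℤ))) 1) :
    esymm (Fin.cons (0 : ℤ) b) 2 <
      esymm (Fin.cons (C + 1) (fun j => C + 1 + (a j : ℤ))) 2 := by
  simp only [esymm_one, Fin.sum_univ_succ, Fin.cons_zero, Fin.cons_succ, zero_add] at h hb
  have hA : 0 ≤ ∑ j, (a j : ℤ) := by positivity
  have hrC : 0 ≤ (r : ℤ) * C := by positivity
  obtain ⟨j, hj⟩ : ∃ j, 2 ≤ b j := by
    by_contra! hlt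
    have hle : ∑ i, b i ≤ ∑ _i : Fin r, (1 : ℤ) :=
      Finset.sum_le_sum fun i _ => by linarith [hlt i]
    simp [Finset.sum_add_distrib] at hle hb
    linarith
  have hsum : ∑ i, (b i - 1 - Pi.single (M := fun _ => ℤ) j 1 i) = ∑ i, b i - r - 1 := by
    simp [Finset.sum_sub_distrib]
  have hsq : ∑ i, (b i - 1 - Pi.single (M := fun _ => ℤ) j 1 i) ^ 2 =
      ∑ i, b i ^ 2 - 2 * ∑ i, b i + r - 2 * b j + 3 := by
    have hi : ∀ i, (b i - 1 - Pi.single (M := fun _ => ℤ) j 1 i) ^ 2 =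
        b i ^ 2 - 2 * b i + 1 + Pi.single (M := fun _ => ℤ) j (3 - 2 * b j) i := by
      intro i
      rcases eq_or_ne i j with rfl | hij
      · simp only [Pi.single_eq_same]; ring
      · simp only [Pi.single_eq_of_ne hij]; ring
    simp only [hi, Finset.sum_add_distrib, Finset.sum_sub_distrib, ← Finset.mul_sum,
      Finset.sum_pi_single', Finset.mem_univ, if_true, Finset.sum_const, Finset.card_univ,
      Fintype.card_fin, nsmul_eq_mul, mul_one]
    ring
  have hshift : ∑ i, (C + 1 + (a i : ℤ)) = ∑ i, (C + (a i : ℤ)) + r := by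
    simp [Finset.sum_add_distrib]; ring
  have hshift_sq : ∑ i, (C + 1 + (a i : ℤ)) ^ 2 =
      ∑ i, (C + (a i : ℤ)) ^ 2 + 2 * ∑ i, (C + (a i : ℤ)) + r := by
    have hi : ∀ i, (C + 1 + (a i : ℤ)) ^ 2 =
        (C + (a i : ℤ)) ^ 2 + 2 * (C + (a i : ℤ)) + 1 := fun i => by ring
    simp only [hi, Finset.sum_add_distrib, ← Finset.mul_sum]
    simp
  have hS : ∑ i, (b i - 1 - Pi.single (M := fun _ => ℤ) j 1 i) =
      C + ∑ i, (C + (a i : ℤ)) := by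
    rw [hsum, hb, hshift]; ring
  have hle := h _ hS
  refine lt_of_mul_lt_mul_left ?_ (zero_le_two (α := ℤ))
  replace hle := mul_le_mul_of_nonneg_left hle (zero_le_two (α := ℤ))
  simp only [two_mul_esymm_two, Fin.sum_univ_succ, Fin.cons_zero, Fin.cons_succ, zero_add]
    at hle ⊢
  rw [hS, hsq] at hle
  rw [hb, hshift_sq]
  rw [hshift] at hb ⊢
  linarith

/-- Induction lemma on `σ₂`: if `σ₂(0,b) ≤ σ₂(C, C+a)` for every integer vector `b`
with `σ₁(0,b) = σ₁(C, C+a)`, then for every `n ≥ 1` and every integer vector `b` with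
`σ₁(0,b) = σ₁(C+n, C+n+a)` one has `σ₂(0,b) < σ₂(C+n, C+n+a)`. -/
theorem stmt_3 (r : ℕ) (hr : 1 ≤ r) (C : ℤ) (hC : 1 ≤ C) (a : Fin r → ℕ)
    (h : ∀ b : Fin r → ℤ,
      esymm (Fin.cons (0 : ℤ) b) 1 = esymm (Fin.cons C (fun j => C + (a j : ℤ))) 1 →
      esymm (Fin.cons (0 : ℤ) b) 2 ≤ esymm (Fin.cons C (fun j => C + (a j : ℤ))) 2) :
    ∀ n : ℤ, 1 ≤ n → ∀ b : Fin r → ℤ,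
      esymm (Fin.cons (0 : ℤ) b) 1 =
          esymm (Fin.cons (C + n) (fun j => C + n + (a j : ℤ))) 1 →
        esymm (Fin.cons (0 : ℤ) b) 2 <
          esymm (Fin.cons (C + n) (fun j => C + n + (a j : ℤ))) 2 := by
  intro n hn
  induction n, hn using Int.leInduction with
  | base => exact esymm_two_lt_of_esymm_two_le (by linarith) a h
  | succ n hn ih =>
    simp only [← add_assoc]
    exact esymm_two_lt_of_esymm_two_le (by linarith) a fun b hb => (ih b hb).le
end

section
/- Let r ≥ 1 be an integer, let a = (a_1, …, a_r) and b = (b_1, …, b_r) be vectors of nonnegative integers, and let C be an integer such that σ_i(C, C+a) = σ_i(0, b) for all integers i with 1 ≤ i ≤ r+1. Then C = 0 and b is a permutation of a (equivalently, a and b are equal as multisets). -/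
open Polynomial in
/-- A multiset in a domain is determined by its cardinality and its elementary symmetric
polynomials. -/
theorem Multiset.eq_of_card_eq_of_esymm_eq {R : Type*} [CommRing R] [IsDomain R]
    {s t : Multiset R} (hcard : card s = card t)
    (h : ∀ i, 1 ≤ i → i ≤ card t → s.esymm i = t.esymm i) : s = t := by
  have hprod : (s.map fun x => X + C x).prod = (t.map fun x => X + C x).prod := by
    rw [prod_X_add_C_eq_sum_esymm, prod_X_add_C_eq_sum_esymm, hcard]
    refine Finset.sum_congr rfl fun i hi => ?_
    rcases Nat.eq_zero_or_pos i with rfl | hi0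
    · simp [Multiset.esymm]
    · rw [h i hi0 (Nat.lt_succ_iff.mp (Finset.mem_range.mp hi))]
  have hroots (u : Multiset R) : (u.map fun x => X + C x).prod.roots = u.map Neg.neg := by
    rw [← roots_multiset_prod_X_sub_C (u.map Neg.neg), Multiset.map_map]
    simp
  apply Multiset.map_injective neg_injective
  rw [← hroots, hprod, hroots]

/-- Two families on finite types with the same multiset of values differ by a bijection of the
index types. -/
theorem Multiset.exists_equiv_of_map_univ_eq {α β γ : Type*} [Fintype α] [Fintype β]
    {f : α → γ} {g : β → γ}
    (h : (Finset.univ : Finset α).val.map f = (Finset.univ : Finset β).val.map g) :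
    ∃ e : α ≃ β, ∀ x, f x = g (e x) := by
  classical
  have hfiber (c : γ) : Nonempty ({x // f x = c} ≃ {y // g y = c}) := by
    rw [← Fintype.card_eq, Fintype.card_subtype, Fintype.card_subtype]
    have hc := congrArg (count c) h
    rw [count_map, count_map] at hc
    simp only [eq_comm (a := c)] at hc
    exact hc
  let e (c : γ) := (hfiber c).some
  exact ⟨Equiv.ofFiberEquiv e, fun x => (Equiv.ofFiberEquiv_map e x).symm⟩

theorem esymm_eq_multiset_esymm {R : Type*} [CommSemiring R] {n : ℕ} (v : Fin n → R) (k : ℕ) :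
    esymm v k = ((Finset.univ : Finset (Fin n)).val.map v).esymm k :=
  (Finset.esymm_map_val v Finset.univ k).symm

/-- If `σᵢ(C, C+a) = σᵢ(0, b)` for all `1 ≤ i ≤ r+1`, where `a, b` are nonnegative
integer vectors of length `r` and `C` is an integer, then `C = 0` and `b` is a
permutation of `a`. -/
theorem stmt_4 (r : ℕ) (hr : 1 ≤ r) (a b : Fin r → ℕ) (C : ℤ)
    (h : ∀ i : ℕ, 1 ≤ i → i ≤ r + 1 →
      esymm (Fin.cons C (fun j => C + (a j : ℤ))) i =
        esymm (Fin.cons (0 : ℤ) (fun j => (b j : ℤ))) i) :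
    C = 0 ∧ ∃ π : Equiv.Perm (Fin r), ∀ i, b i = a (π i) := by
  have hcons (c : ℤ) (v : Fin r → ℤ) :
      (Finset.univ : Finset (Fin (r + 1))).val.map (Fin.cons c v : Fin (r + 1) → ℤ) =
        c ::ₘ (Finset.univ : Finset (Fin r)).val.map v := by
    simp [Fin.univ_succ, Function.comp_def]
  have hm : C ::ₘ (Finset.univ : Finset (Fin r)).val.map (fun j => C + (a j : ℤ)) =
      0 ::ₘ (Finset.univ : Finset (Fin r)).val.map (fun j => (b j : ℤ)) := by
    refine Multiset.eq_of_card_eq_of_esymm_eq (by simp) fun i hi hi' => ?_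
    rw [← hcons, ← hcons, ← esymm_eq_multiset_esymm, ← esymm_eq_multiset_esymm]
    exact h i hi (by simpa using hi')
  have hC : C = 0 := by
    apply le_antisymm
    · have h0 : (0 : ℤ) ∈ C ::ₘ (Finset.univ : Finset (Fin r)).val.map
          (fun j => C + (a j : ℤ)) := hm ▸ Multiset.mem_cons_self _ _
      rcases Multiset.mem_cons.mp h0 with h0 | h0
      · exact h0.ge
      · obtain ⟨j, -, hj⟩ := Multiset.mem_map.mp h0
        lia
    · have h0 : C ∈ 0 ::ₘ (Finset.univ : Finset (Fin r)).val.map (fun j => (b j : ℤ)) :=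
        hm ▸ Multiset.mem_cons_self _ _
      rcases Multiset.mem_cons.mp h0 with h0 | h0
      · exact h0.ge
      · obtain ⟨j, -, hj⟩ := Multiset.mem_map.mp h0
        lia
  refine ⟨hC, ?_⟩
  subst hC
  have hab : (Finset.univ : Finset (Fin r)).val.map a = Finset.univ.val.map b := by
    apply Multiset.map_injective (Nat.cast_injective (R := ℤ))
    simpa [Multiset.map_map, Function.comp_def] using hm
  exact Multiset.exists_equiv_of_map_univ_eq hab.symm
end

section
/- For every integer r ≥ 2 and every positive integer k, there exist a vector a = (a_1, …, a_r) of nonnegative integers, k nondecreasing vectors b^{(1)}, …, b^{(k)} of nonnegative integers of length r that are pairwise distinct, and integers C_1, …, C_k, such that σ_i(C_j, C_j + a) = σ_i(0, b^{(j)}) for i = 1 and i = 2 and for every j with 1 ≤ j ≤ k. -/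
/-- Integer tuples with equal sums and equal sums of squares have equal first and second
elementary symmetric polynomials. -/
theorem esymm_eq_of_sum_eq_of_sum_sq_eq {n : ℕ} {v w : Fin n → ℤ}
    (h₁ : ∑ i, v i = ∑ i, w i) (h₂ : ∑ i, v i ^ 2 = ∑ i, w i ^ 2) {i : ℕ}
    (hi : i = 1 ∨ i = 2) : esymm v i = esymm w i := by
  rcases hi with rfl | rfl
  · rw [esymm_one, esymm_one, h₁]
  · have hv := two_mul_esymm_two v
    rw [h₁, h₂, ← two_mul_esymm_two w] at hv
    linarith

/-- The vector `(0, …, 0, x, y)` of length `t + 2`. -/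
def lastTwo (t x y : ℕ) : Fin (t + 2) → ℕ :=
  Fin.snoc (Fin.snoc (fun _ => 0) x : Fin (t + 1) → ℕ) y

theorem lastTwo_monotone (t : ℕ) {x y : ℕ} (h : x ≤ y) : Monotone (lastTwo t x y) := by
  rw [Fin.monotone_iff_le_succ]
  intro i
  induction i using Fin.lastCases with
  | last => simpa [lastTwo] using h
  | cast i =>
    rw [Fin.succ_castSucc]
    simp [lastTwo]

theorem sum_lastTwo {M : Type*} [AddCommMonoid M] (t x y : ℕ) (f : ℕ → M) :
    ∑ i, f (lastTwo t x y i) = t • f 0 + f x + f y := by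
  simp [lastTwo, Fin.sum_univ_castSucc]

/-- For every `r ≥ 2` and `k ≥ 1` there are a nonnegative integer vector `a` of
length `r`, `k` pairwise distinct nondecreasing nonnegative integer vectors
`b⁽ʲ⁾` of length `r`, and integers `Cⱼ`, with
`σᵢ(Cⱼ, Cⱼ+a) = σᵢ(0, b⁽ʲ⁾)` for `i = 1, 2` and all `j`. -/
theorem stmt_8 (r : ℕ) (hr : 2 ≤ r) (k : ℕ) (hk : 1 ≤ k) :
    ∃ (a : Fin r → ℕ) (b : Fin k → Fin r → ℕ) (C : Fin k → ℤ),
      (∀ j, Monotone (b j)) ∧ Function.Injective b ∧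
      ∀ j, ∀ i : ℕ, i = 1 ∨ i = 2 →
        esymm (Fin.cons (C j) (fun t => C j + (a t : ℤ))) i =
          esymm (Fin.cons (0 : ℤ) (fun t => (b j t : ℤ))) i := by
  obtain ⟨t, rfl⟩ := Nat.exists_eq_add_of_le' hr
  -- Rational points on the conic `(r - 1) s² + (r + 1) d² = r - 1` with denominators `D j`,
  -- in the coordinates `s = x + y`, `d = y - x`.
  let D : Fin k → ℕ := fun j => (t + 1) * ((j : ℕ) + 3) ^ 2 + (t + 3)
  have hD : ∀ j, 0 < D j := fun j => by positivity
  let E : ℕ := ∏ j, D j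
  have hE : 0 < E := Finset.prod_pos fun j _ => hD j
  have hdvd : ∀ j, ∃ q, E = D j * q := fun j => Finset.dvd_prod_of_mem D (Finset.mem_univ j)
  choose q hq using hdvd
  let u : Fin k → ℕ := fun j => (t + 1) * ((j : ℕ) ^ 2 + 4 * j) + 2 * t
  let x : Fin k → ℕ := fun j => (t + 3) * q j * u j
  let y : Fin k → ℕ := fun j => (t + 3) * q j * (u j + 4 * (t + 1) * (j + 3))
  have hsum : ∀ j, x j + y j + 4 * (t + 3) ^ 2 * q j = 2 * (t + 3) * E := fun j => by
    rw [hq j]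
    simp only [x, y, u, D]
    ring
  refine ⟨lastTwo t ((t + 3) * E) ((t + 3) * E), fun j => lastTwo t (x j) (y j),
    fun j => -4 * (t + 3) * q j, fun j => lastTwo_monotone t ?_, fun j j' hjj => ?_,
    fun j i hi => esymm_eq_of_sum_eq_of_sum_sq_eq ?_ ?_ hi⟩
  · exact Nat.mul_le_mul_left _ (Nat.le_add_right _ _)
  · have hxy : x j + y j = x j' + y j' := by
      simpa [sum_lastTwo t _ _ (fun n => n)] using congrArg (fun v => ∑ i, v i) hjj
    have hqq : q j = q j' := by
      have h₁ := hsum j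
      rw [hxy, ← hsum j'] at h₁
      exact Nat.eq_of_mul_eq_mul_left (by positivity) (Nat.add_left_cancel h₁)
    have hDD : D j = D j' := by
      have hqpos : 0 < q j' := Nat.pos_of_ne_zero fun h => by
        have := hq j'
        simp [h] at this
        omega
      refine Nat.eq_of_mul_eq_mul_right hqpos ?_
      rw [← hq j', ← hqq, ← hq j]
    have hpow : ((j : ℕ) + 3) ^ 2 = ((j' : ℕ) + 3) ^ 2 :=
      Nat.eq_of_mul_eq_mul_left (Nat.succ_pos t) (Nat.add_right_cancel hDD)
    have := Nat.pow_left_injective (n := 2) (by norm_num) hpow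
    ext
    omega
  · simp only [Fin.sum_univ_succ (n := t + 2), Fin.cons_zero, Fin.cons_succ]
    rw [sum_lastTwo t _ _ (fun n => (-4 * (t + 3) * q j + n : ℤ)),
      sum_lastTwo t _ _ (fun n => (n : ℤ)), hq j]
    simp only [x, y, u, D, nsmul_eq_mul]
    push_cast
    ring
  · simp only [Fin.sum_univ_succ (n := t + 2), Fin.cons_zero, Fin.cons_succ]
    rw [sum_lastTwo t _ _ (fun n => (-4 * (t + 3) * q j + n : ℤ) ^ 2),
      sum_lastTwo t _ _ (fun n => (n : ℤ) ^ 2), hq j]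
    simp only [x, y, u, D, nsmul_eq_mul]
    push_cast
    ring
end

section
/- Let r, s ≥ 1 be integers. For a nondecreasing vector a = (a_1, …, a_r) of nonnegative integers (0 ≤ a_1 ≤ … ≤ a_r) and a real number κ with κ > σ_1(a) − s, define the polytope Δ_a^κ = {(x, z) ∈ ℝ^r × ℝ^s : x_i ≥ −1 for 1 ≤ i ≤ r, z_j ≥ −1 for 1 ≤ j ≤ s, x_1 + … + x_r ≤ 1, and z_1 + … + z_s ≤ κ + a_1 x_1 + … + a_r x_r}. Suppose a and b are two such nondecreasing nonnegative integer vectors of length r, κ > σ_1(a) − s and κ' > σ_1(b) − s are real numbers, and there exist an (r+s)×(r+s) integer matrix M with det M = ±1 and a vector v ∈ ℝ^{r+s} such that the affine map u ↦ M·u + v maps Δ_a^κ onto Δ_b^{κ'}. Then a = b and κ = κ'. -/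
/-- The moment polytope `Δ_a^κ ⊆ ℝ^{r+s}` of the toric `ℂPʳ`-bundle over `ℂPˢ`
determined by `(a; κ)`. -/
def Delta (r s : ℕ) (a : Fin r → ℕ) (κ : ℝ) : Set (Fin (r + s) → ℝ) :=
  {u | (∀ i, -1 ≤ u i) ∧
    (∑ i : Fin r, u (Fin.castAdd s i)) ≤ 1 ∧
    (∑ j : Fin s, u (Fin.natAdd r j)) ≤ κ + ∑ i : Fin r, (a i : ℝ) * u (Fin.castAdd s i)}

open Matrix Filter Topology

/-- Casting an integer matrix identity `A * B = 1` to the reals. -/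
lemma map_intCast_mulVec_mulVec {ι : Type*} [Fintype ι] [DecidableEq ι] {A B : Matrix ι ι ℤ}
    (h : A * B = 1) (u : ι → ℝ) :
    (A.map fun z : ℤ => (z : ℝ)) *ᵥ ((B.map fun z : ℤ => (z : ℝ)) *ᵥ u) = u := by
  have h1 : (A.map fun z : ℤ => (z : ℝ)) * (B.map fun z : ℤ => (z : ℝ)) = 1 := by
    have := (Matrix.map_mul (L := A) (M := B) (f := Int.castRingHom ℝ)).symm
    rw [h] at this
    simpa using this
  rw [mulVec_mulVec, h1, one_mulVec]

/-- A point with nonnegative coordinates can be moved a little in a direction that is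
nonnegative wherever the point is not positive. -/
lemma exists_pos_forall_nonneg_add_mul {K : Type*} [Finite K] (x y : K → ℝ)
    (hxy : ∀ k, 0 < x k ∨ 0 ≤ x k ∧ 0 ≤ y k) : ∃ t : ℝ, 0 < t ∧ ∀ k, 0 ≤ x k + t * y k := by
  have hev : ∀ᶠ t : ℝ in 𝓝[>] 0, ∀ k, 0 ≤ x k + t * y k := by
    refine eventually_all.2 fun k => ?_
    rcases hxy k with hk | ⟨hx, hy⟩
    · have hc : Tendsto (fun t : ℝ => x k + t * y k) (𝓝[>] 0) (𝓝 (x k + 0 * y k)) :=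
        ((by fun_prop : Continuous fun t : ℝ => x k + t * y k).tendsto 0).mono_left
          nhdsWithin_le_nhds
      rw [zero_mul, add_zero] at hc
      exact (hc.eventually (lt_mem_nhds hk)).mono fun t ht => ht.le
    · filter_upwards [self_mem_nhdsWithin] with t ht
      have ht' : (0 : ℝ) < t := ht
      positivity
  obtain ⟨t, ht, ht0⟩ := (hev.and self_mem_nhdsWithin).exists
  exact ⟨t, ht0, ht⟩

/-- The affine function with integral linear part `n` and constant term `c`. -/
def affineForm {ι : Type*} [Fintype ι] (n : ι → ℤ) (c : ℝ) (u : ι → ℝ) : ℝ :=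
  (fun i => (n i : ℝ)) ⬝ᵥ u + c

/-- An integral affine equivalence between two polytopes given by primitive integral
inequalities, those of the first being irredundant, permutes the defining affine functions. -/
theorem exists_perm_affineForm_eq {ι K : Type*} [Fintype ι] [DecidableEq ι] [Finite K]
    (N N' : K → ι → ℤ) (c c' : K → ℝ)
    (hN : ∀ k, ∃ w, N k ⬝ᵥ w = 1) (hN' : ∀ k, ∃ w, N' k ⬝ᵥ w = 1)
    (hfacet : ∀ k, ∃ p, affineForm (N k) (c k) p = 0 ∧
      ∀ m, m ≠ k → 0 < affineForm (N m) (c m) p)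
    (M : Matrix ι ι ℤ) (hM : IsUnit M.det) (v : ι → ℝ)
    (h : (fun u => (M.map fun z : ℤ => (z : ℝ)).mulVec u + v) ''
        {u | ∀ k, 0 ≤ affineForm (N k) (c k) u} = {u | ∀ k, 0 ≤ affineForm (N' k) (c' k) u}) :
    ∃ π : Equiv.Perm K, ∀ k u, affineForm (N' (π k)) (c' (π k))
      ((M.map fun z : ℤ => (z : ℝ)).mulVec u + v) = affineForm (N k) (c k) u := by
  set L : Matrix ι ι ℝ := M.map fun z : ℤ => (z : ℝ) with hL
  have castDot (n w : ι → ℤ) :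
      (fun i => (n i : ℝ)) ⬝ᵥ (fun i => (w i : ℝ)) = ((n ⬝ᵥ w : ℤ) : ℝ) := by
    simp [dotProduct]
  have castMul (w : ι → ℤ) : L *ᵥ (fun i => (w i : ℝ)) = fun i => ((M *ᵥ w) i : ℝ) := by
    ext i; simp [hL, mulVec, dotProduct]
  have castInv : ∀ u, L *ᵥ ((M⁻¹.map fun z : ℤ => (z : ℝ)) *ᵥ u) = u :=
    map_intCast_mulVec_mulVec (M.mul_nonsing_inv hM)
  have castInv' : ∀ u, (M⁻¹.map fun z : ℤ => (z : ℝ)) *ᵥ (L *ᵥ u) = u :=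
    map_intCast_mulVec_mulVec (M.nonsing_inv_mul hM)
  have form_add (n : ι → ℤ) (b : ℝ) (p d : ι → ℝ) (t : ℝ) : affineForm n b (p + t • d) =
      affineForm n b p + t * ((fun i => (n i : ℝ)) ⬝ᵥ d) := by
    simp [affineForm, dotProduct_add, dotProduct_smul]; ring
  have map_add (p d : ι → ℝ) (t : ℝ) :
      L *ᵥ (p + t • d) + v = (L *ᵥ p + v) + t • (L *ᵥ d) := by
    rw [mulVec_add, mulVec_smul]; abel
  have mem_iff (u : ι → ℝ) : (∀ k, 0 ≤ affineForm (N' k) (c' k) (L *ᵥ u + v)) ↔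
      ∀ k, 0 ≤ affineForm (N k) (c k) u := by
    constructor
    · intro hu
      obtain ⟨u', hu', he⟩ := h.symm.subset hu
      have he' : L *ᵥ u' = L *ᵥ u := add_right_cancel he
      have : u' = u := by rw [← castInv' u', he', castInv']
      exact this ▸ hu'
    · intro hu
      exact h.subset ⟨u, hu, rfl⟩
  have key : ∀ k, ∃ m, ∀ u, affineForm (N' m) (c' m) (L *ᵥ u + v) =
      affineForm (N k) (c k) u := by
    intro k
    obtain ⟨p, hp0, hp⟩ := hfacet k
    obtain ⟨w, hw⟩ := hN k
    have hwR : (fun i => (N k i : ℝ)) ⬝ᵥ (fun i => (w i : ℝ)) = 1 := by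
      rw [castDot, hw]; simp
    have hpmem : ∀ m, 0 ≤ affineForm (N m) (c m) p := fun m => by
      by_cases hm : m = k
      · rw [hm, hp0]
      · exact (hp m hm).le
    have hqmem := (mem_iff p).2 hpmem
    obtain ⟨m, hm⟩ : ∃ m, affineForm (N' m) (c' m) (L *ᵥ p + v) = 0 := by
      by_contra! hne
      obtain ⟨t, ht, hall⟩ := exists_pos_forall_nonneg_add_mul
        (fun m => affineForm (N' m) (c' m) (L *ᵥ p + v))
        (fun m => (fun i => (N' m i : ℝ)) ⬝ᵥ (L *ᵥ (-fun i => (w i : ℝ))))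
        (fun m => Or.inl (lt_of_le_of_ne (hqmem m) (hne m).symm))
      have := (mem_iff (p + t • (-fun i => (w i : ℝ)))).1 (fun m => by
        rw [map_add, form_add]; exact hall m) k
      rw [form_add, hp0, dotProduct_neg, hwR] at this
      linarith
    have hnonneg : ∀ d, 0 ≤ (fun i => (N k i : ℝ)) ⬝ᵥ d →
        0 ≤ (fun i => (N' m i : ℝ)) ⬝ᵥ (L *ᵥ d) := by
      intro d hd
      obtain ⟨t, ht, hall⟩ := exists_pos_forall_nonneg_add_mul
        (fun m => affineForm (N m) (c m) p) (fun m => (fun i => (N m i : ℝ)) ⬝ᵥ d)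
        (fun m => by
          by_cases hm : m = k
          · subst hm; exact Or.inr ⟨hp0.ge, hd⟩
          · exact Or.inl (hp m hm))
      have := (mem_iff (p + t • d)).2 (fun m => by rw [form_add]; exact hall m) m
      rw [map_add, form_add, hm, zero_add] at this
      exact nonneg_of_mul_nonneg_right this ht
    set z : ℤ := N' m ⬝ᵥ (M *ᵥ w) with hz
    have hzR : (fun i => (N' m i : ℝ)) ⬝ᵥ (L *ᵥ fun i => (w i : ℝ)) = z := by
      rw [castMul, castDot]
    have hprop : ∀ d, (fun i => (N' m i : ℝ)) ⬝ᵥ (L *ᵥ d) =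
        ((fun i => (N k i : ℝ)) ⬝ᵥ d) * z := by
      intro d
      set s := (fun i => (N k i : ℝ)) ⬝ᵥ d with hs
      have h1 := hnonneg (d - s • fun i => (w i : ℝ)) (by
        rw [dotProduct_sub, dotProduct_smul, hwR, ← hs]; simp)
      have h2 := hnonneg (s • (fun i => (w i : ℝ)) - d) (by
        rw [dotProduct_sub, dotProduct_smul, hwR, ← hs]; simp)
      rw [mulVec_sub, mulVec_smul, dotProduct_sub, dotProduct_smul, hzR, smul_eq_mul] at h1 h2
      linarith
    have hz0 : 0 ≤ z := by
      have := hnonneg (fun i => (w i : ℝ)) (by rw [hwR]; norm_num)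
      rw [hzR] at this
      exact_mod_cast this
    have hz1 : z = 1 := by
      obtain ⟨w', hw'⟩ := hN' m
      have h1 := hprop (fun i => ((M⁻¹ *ᵥ w') i : ℝ))
      rw [castMul, castDot, castDot, mulVec_mulVec, M.mul_nonsing_inv hM, one_mulVec, hw'] at h1
      have h2 : (N k ⬝ᵥ (M⁻¹ *ᵥ w')) * z = 1 := by exact_mod_cast h1.symm
      exact Int.eq_one_of_dvd_one hz0 ⟨_, by rw [mul_comm]; exact h2.symm⟩
    refine ⟨m, fun u => ?_⟩
    have hu : u = p + (1 : ℝ) • (u - p) := by simp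
    rw [hu, map_add, form_add, form_add, hm, hp0, hprop, hz1]
    simp
  choose π hπ using key
  have hinj : Function.Injective π := by
    intro k l hkl
    by_contra hne
    obtain ⟨p, hp0, hp⟩ := hfacet k
    have h1 := hp l (Ne.symm hne)
    rw [← hπ, ← hkl, hπ, hp0] at h1
    exact lt_irrefl _ h1
  exact ⟨Equiv.ofBijective π (Finite.injective_iff_bijective.1 hinj), hπ⟩

/-- The inward normals of the facets of `Delta r s a κ`. -/
def facetNormal (r s : ℕ) (a : Fin r → ℕ) : Option (Fin r) ⊕ Option (Fin s) → Fin (r + s) → ℤ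
  | Sum.inl (some i) => Pi.single (Fin.castAdd s i) 1
  | Sum.inl none => Fin.append (fun _ => -1) (fun _ => 0)
  | Sum.inr (some j) => Pi.single (Fin.natAdd r j) 1
  | Sum.inr none => Fin.append (fun i => (a i : ℤ)) (fun _ => -1)

/-- The support numbers of the facets of `Delta r s a κ`. -/
def facetConst (r s : ℕ) (κ : ℝ) : Option (Fin r) ⊕ Option (Fin s) → ℝ
  | Sum.inr none => κ
  | _ => 1

/-- The affine functions whose nonnegativity defines `Delta r s a κ`. -/
def slack (r s : ℕ) (a : Fin r → ℕ) (κ : ℝ) (k : Option (Fin r) ⊕ Option (Fin s)) :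
    (Fin (r + s) → ℝ) → ℝ :=
  affineForm (facetNormal r s a k) (facetConst r s κ k)

section slack

variable {r s : ℕ} (a : Fin r → ℕ) (κ : ℝ) (u : Fin (r + s) → ℝ)

lemma slack_inl_some (i : Fin r) :
    slack r s a κ (Sum.inl (some i)) u = u (Fin.castAdd s i) + 1 := by
  simp [slack, affineForm, facetNormal, facetConst, dotProduct, Pi.single_apply]

lemma slack_inl_none :
    slack r s a κ (Sum.inl none) u = 1 - ∑ i : Fin r, u (Fin.castAdd s i) := by
  simp [slack, affineForm, facetNormal, facetConst, dotProduct, Fin.sum_univ_add]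
  ring

lemma slack_inr_some (j : Fin s) :
    slack r s a κ (Sum.inr (some j)) u = u (Fin.natAdd r j) + 1 := by
  simp [slack, affineForm, facetNormal, facetConst, dotProduct, Pi.single_apply]

lemma slack_inr_none :
    slack r s a κ (Sum.inr none) u = κ + ∑ i : Fin r, (a i : ℝ) * u (Fin.castAdd s i) -
      ∑ j : Fin s, u (Fin.natAdd r j) := by
  simp [slack, affineForm, facetNormal, facetConst, dotProduct, Fin.sum_univ_add]
  ring

lemma Delta_eq_setOf_slack_nonneg : Delta r s a κ = {u | ∀ k, 0 ≤ slack r s a κ k u} := by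
  ext u
  simp only [Delta, Set.mem_ofPred_eq, Sum.forall, Option.forall, slack_inl_some, slack_inl_none,
    slack_inr_some, slack_inr_none, sub_nonneg]
  constructor
  · rintro ⟨h1, h2, h3⟩
    exact ⟨⟨h2, fun i => by linarith [h1 (Fin.castAdd s i)]⟩, h3,
      fun j => by linarith [h1 (Fin.natAdd r j)]⟩
  · rintro ⟨⟨h2, h1⟩, h3, h4⟩
    refine ⟨fun i => ?_, h2, h3⟩
    induction i using Fin.addCases with
    | left i => linarith [h1 i]
    | right j => linarith [h4 j]

/-- The fibre coefficients, extended by zero to the remaining facet of the base simplex. -/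
def extendZero (a : Fin r → ℕ) (e : Option (Fin r)) : ℝ := e.elim 0 fun i => (a i : ℝ)

lemma extendZero_nonneg (e : Option (Fin r)) : 0 ≤ extendZero a e := by
  cases e <;> simp [extendZero]

lemma sum_slack_inl : ∑ e, slack r s a κ (Sum.inl e) u = r + 1 := by
  simp only [Fintype.sum_option, slack_inl_none, slack_inl_some, Finset.sum_add_distrib]
  simp
  ring

lemma sum_slack_inr : ∑ f, slack r s a κ (Sum.inr f) u =
    (κ + s - ∑ i, (a i : ℝ)) + ∑ e, extendZero a e * slack r s a κ (Sum.inl e) u := by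
  simp only [Fintype.sum_option, slack_inr_none, slack_inr_some, slack_inl_some,
    Finset.sum_add_distrib, extendZero, Option.elim, mul_add]
  simp
  ring

lemma exists_slack_eq (w : Option (Fin r) → ℝ) (hw : ∑ e, w e = 1)
    (y : Option (Fin s) → ℝ) (hy : ∑ f, y f = 1) :
    ∃ u, (∀ e, slack r s a κ (Sum.inl e) u = (r + 1) * w e) ∧
      ∀ f, slack r s a κ (Sum.inr f) u =
        ((κ + s - ∑ i, (a i : ℝ)) + ∑ e, extendZero a e * ((r + 1) * w e)) * y f := by
  set C := (κ + s - ∑ i, (a i : ℝ)) + ∑ e, extendZero a e * ((r + 1) * w e) with hC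
  set u : Fin (r + s) → ℝ := Fin.append (fun i => (r + 1) * w (some i) - 1)
    (fun j => C * y (some j) - 1) with hu
  have h1 : ∀ i, slack r s a κ (Sum.inl (some i)) u = (r + 1) * w (some i) := fun i => by
    simp [slack_inl_some, hu]
  have h2 : ∀ j, slack r s a κ (Sum.inr (some j)) u = C * y (some j) := fun j => by
    simp [slack_inr_some, hu]
  have h3 : slack r s a κ (Sum.inl none) u = (r + 1) * w none := by
    have h := sum_slack_inl (s := s) a κ u
    rw [Fintype.sum_option] at h hw
    simp only [h1, ← Finset.mul_sum] at h
    linear_combination h - (r + 1) * hw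
  have h4 : ∀ e, slack r s a κ (Sum.inl e) u = (r + 1) * w e := Option.forall.2 ⟨h3, h1⟩
  refine ⟨u, h4, Option.forall.2 ⟨?_, h2⟩⟩
  have h := sum_slack_inr (s := s) a κ u
  simp only [h4, ← hC] at h
  rw [Fintype.sum_option] at h hy
  simp only [h2, ← Finset.mul_sum] at h
  linear_combination h - C * hy

lemma exists_facetNormal_dotProduct_eq_one (hr : 1 ≤ r) (hs : 1 ≤ s)
    (k : Option (Fin r) ⊕ Option (Fin s)) : ∃ w, facetNormal r s a k ⬝ᵥ w = 1 := by
  rcases k with (_ | i) | (_ | j)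
  · exact ⟨Pi.single (Fin.castAdd s ⟨0, hr⟩) (-1), by
      rw [dotProduct_single, facetNormal, Fin.append_left]; norm_num⟩
  · exact ⟨Pi.single (Fin.castAdd s i) 1, by simp [facetNormal]⟩
  · exact ⟨Pi.single (Fin.natAdd r ⟨0, hs⟩) (-1), by
      rw [dotProduct_single, facetNormal, Fin.append_right]; norm_num⟩
  · exact ⟨Pi.single (Fin.natAdd r j) 1, by simp [facetNormal]⟩

lemma height_pos (hκ : (∑ i, (a i : ℝ)) - s < κ) (w : Option (Fin r) → ℝ) (hw : ∀ e, 0 ≤ w e) :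
    0 < (κ + s - ∑ i, (a i : ℝ)) + ∑ e, extendZero a e * ((r + 1) * w e) := by
  have : 0 ≤ ∑ e, extendZero a e * ((r + 1) * w e) := Finset.sum_nonneg fun e _ =>
    mul_nonneg (extendZero_nonneg a e) (mul_nonneg (by positivity) (hw e))
  linarith

lemma exists_facet_point (hr : 1 ≤ r) (hs : 1 ≤ s) (hκ : (∑ i, (a i : ℝ)) - s < κ)
    (k : Option (Fin r) ⊕ Option (Fin s)) :
    ∃ p, slack r s a κ k p = 0 ∧ ∀ m, m ≠ k → 0 < slack r s a κ m p := by
  have unif (n : ℕ) : ∑ _e : Option (Fin n), (1 / ((n : ℝ) + 1)) = 1 := by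
    simp; field_simp
  have punct (n : ℕ) (hn : 1 ≤ n) (e : Option (Fin n)) :
      ∑ e', (if e' = e then 0 else 1 / (n : ℝ)) = 1 := by
    have hn' : (n : ℝ) ≠ 0 := by positivity
    have : ∀ e', (if e' = e then 0 else 1 / (n : ℝ)) =
        1 / (n : ℝ) - (if e' = e then 1 / (n : ℝ) else 0) := fun e' => by split_ifs <;> simp
    simp only [this, Finset.sum_sub_distrib]
    simp
    field_simp
    ring
  have hr' : (0 : ℝ) < r := by positivity
  have hs' : (0 : ℝ) < s := by positivity
  rcases k with e | f
  · obtain ⟨p, hp1, hp2⟩ := exists_slack_eq a κ _ (punct r hr e) _ (unif s)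
    have hpos := height_pos a κ hκ (fun e' => if e' = e then 0 else 1 / (r : ℝ))
      (fun e' => by split_ifs <;> positivity)
    refine ⟨p, by simp [hp1], Sum.forall.2 ⟨fun e' he => ?_, fun f _ => ?_⟩⟩
    · have he' : e' ≠ e := fun h => he (h ▸ rfl)
      rw [hp1, if_neg he']; positivity
    · rw [hp2]; exact mul_pos hpos (by positivity)
  · obtain ⟨p, hp1, hp2⟩ := exists_slack_eq a κ _ (unif r) _ (punct s hs f)
    have hpos := height_pos a κ hκ (fun _ => 1 / ((r : ℝ) + 1)) (fun _ => by positivity)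
    refine ⟨p, by simp [hp2], Sum.forall.2 ⟨fun e _ => ?_, fun f' hf => ?_⟩⟩
    · rw [hp1]; positivity
    · have hf' : f' ≠ f := fun h => hf (h ▸ rfl)
      rw [hp2, if_neg hf']; exact mul_pos hpos (by positivity)

/-- The vertex off the facets `e` and `f`. -/
lemma exists_vertex (hκ : (∑ i, (a i : ℝ)) - s < κ) (e : Option (Fin r)) (f : Option (Fin s)) :
    ∃ p, (∀ k, 0 ≤ slack r s a κ k p) ∧
      (∀ e', slack r s a κ (Sum.inl e') p = if e' = e then (r : ℝ) + 1 else 0) ∧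
      ∀ f', f' ≠ f → slack r s a κ (Sum.inr f') p = 0 := by
  obtain ⟨p, hp1, hp2⟩ := exists_slack_eq a κ (fun e' => if e' = e then 1 else 0) (by simp)
    (fun f' => if f' = f then 1 else 0) (by simp)
  have hpos := height_pos a κ hκ (fun e' => if e' = e then 1 else 0)
    (fun e' => by split_ifs <;> norm_num)
  refine ⟨p, Sum.forall.2 ⟨fun e' => ?_, fun f' => ?_⟩, fun e' => by simp [hp1],
    fun f' hf => by simp [hp2, hf]⟩
  · rw [hp1]; split_ifs <;> positivity
  · rw [hp2]; exact mul_nonneg hpos.le (by split_ifs <;> norm_num)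

lemma not_forall_slack_inl_eq_zero : ¬ ∀ e, slack r s a κ (Sum.inl e) u = 0 := fun h => by
  have := sum_slack_inl (s := s) a κ u
  simp only [h, Finset.sum_const_zero] at this
  linarith [(Nat.cast_nonneg r : (0 : ℝ) ≤ r)]

lemma not_forall_slack_inr_eq_zero (hκ : (∑ i, (a i : ℝ)) - s < κ)
    (hu : ∀ k, 0 ≤ slack r s a κ k u) : ¬ ∀ f, slack r s a κ (Sum.inr f) u = 0 := fun h => by
  have h1 := sum_slack_inr (s := s) a κ u
  simp only [h, Finset.sum_const_zero] at h1
  have h2 : 0 ≤ ∑ e, extendZero a e * slack r s a κ (Sum.inl e) u :=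
    Finset.sum_nonneg fun e _ => mul_nonneg (extendZero_nonneg a e) (hu _)
  linarith

/-- If the height of the fibre is constant, then the bundle is trivial. -/
lemma eq_zero_of_sum_slack_inr_const (hκ : (∑ i, (a i : ℝ)) - s < κ) {C : ℝ}
    (hC : ∀ u, ∑ f, slack r s a κ (Sum.inr f) u = C) :
    κ + s - ∑ i, (a i : ℝ) = C ∧ a = 0 := by
  have key : ∀ e, (κ + s - ∑ i, (a i : ℝ)) + extendZero a e * (r + 1) = C := fun e => by
    obtain ⟨p, -, hp, -⟩ := exists_vertex a κ hκ e none
    rw [← hC p, sum_slack_inr]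
    simp [hp]
  have h0 : κ + s - ∑ i, (a i : ℝ) = C := by simpa [extendZero] using key none
  refine ⟨h0, funext fun i => ?_⟩
  have h1 := key (some i)
  have h2 : extendZero a (some i) * ((r : ℝ) + 1) = 0 := by linarith
  rcases mul_eq_zero.1 h2 with h3 | h3
  · simpa [extendZero] using h3
  · exact absurd h3 (by positivity)

end slack

lemma eq_of_extendZero_comp_eq {r : ℕ} {a b : Fin r → ℕ} (ha : Monotone a) (hb : Monotone b)
    (σ : Equiv.Perm (Option (Fin r))) (hσ : ∀ e, extendZero a e = extendZero b (σ e)) :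
    a = b := by
  have hab : a = b ∘ (Equiv.removeNone σ) := by
    funext i
    have : extendZero a (some i) = extendZero b (some (Equiv.removeNone σ i)) := by
      by_cases hi : σ (some i) = none
      · rw [Equiv.removeNone_none σ hi, ← hσ, hσ, hi]
        rfl
      · rw [Equiv.removeNone_some σ (Option.ne_none_iff_exists'.1 hi), hσ]
    simpa [extendZero] using this
  have := Tuple.unique_monotone (f := b) (σ := Equiv.removeNone σ) (τ := 1) (hab ▸ ha) hb
  rw [hab, this]
  rfl

/-- A permutation of a disjoint union that sends each part onto a superset of one of the parts
either preserves or exchanges the parts. -/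
lemma perm_sum_preserves_or_swaps {α β : Type*} [Finite α] [Finite β] [Nonempty α] [Nonempty β]
    (π : Equiv.Perm (α ⊕ β))
    (hα : (∀ a, ∃ a', π (Sum.inl a') = Sum.inl a) ∨ ∀ b, ∃ a', π (Sum.inl a') = Sum.inr b)
    (hβ : (∀ a, ∃ b', π (Sum.inr b') = Sum.inl a) ∨ ∀ b, ∃ b', π (Sum.inr b') = Sum.inr b) :
    (∃ (σ : Equiv.Perm α) (τ : Equiv.Perm β), (∀ a, π (Sum.inl a) = Sum.inl (σ a)) ∧
      ∀ b, π (Sum.inr b) = Sum.inr (τ b)) ∨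
    ∃ (σ : α ≃ β), ∃ τ : β ≃ α, (∀ a, π (Sum.inl a) = Sum.inr (σ a)) ∧
      ∀ b, π (Sum.inr b) = Sum.inl (τ b) := by
  have excl {a b} (h : π (Sum.inl a) = π (Sum.inr b)) : False :=
    Sum.inl_ne_inr (π.injective h)
  rcases hα with hα | hα <;> rcases hβ with hβ | hβ
  · obtain ⟨a', h1⟩ := hα (Classical.arbitrary α)
    obtain ⟨b', h2⟩ := hβ (Classical.arbitrary α)
    exact (excl (h1.trans h2.symm)).elim
  · left
    have h1 : ∀ a, ∃ a', π (Sum.inl a) = Sum.inl a' := fun a => by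
      rcases h : π (Sum.inl a) with a' | b
      · exact ⟨a', rfl⟩
      · obtain ⟨b', hb'⟩ := hβ b
        exact (excl (h.trans hb'.symm)).elim
    have h2 : ∀ b, ∃ b', π (Sum.inr b) = Sum.inr b' := fun b => by
      rcases h : π (Sum.inr b) with a | b'
      · obtain ⟨a', ha'⟩ := hα a
        exact (excl (ha'.trans h.symm)).elim
      · exact ⟨b', rfl⟩
    choose σ hσ using h1
    choose τ hτ using h2
    have iσ : Function.Injective σ := fun x y h =>
      Sum.inl_injective (π.injective (by rw [hσ, hσ, h]))
    have iτ : Function.Injective τ := fun x y h =>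
      Sum.inr_injective (π.injective (by rw [hτ, hτ, h]))
    exact ⟨Equiv.ofBijective σ (Finite.injective_iff_bijective.1 iσ),
      Equiv.ofBijective τ (Finite.injective_iff_bijective.1 iτ), hσ, hτ⟩
  · right
    have h1 : ∀ a, ∃ b', π (Sum.inl a) = Sum.inr b' := fun a => by
      rcases h : π (Sum.inl a) with a' | b
      · obtain ⟨b', hb'⟩ := hβ a'
        exact (excl (h.trans hb'.symm)).elim
      · exact ⟨b, rfl⟩
    have h2 : ∀ b, ∃ a', π (Sum.inr b) = Sum.inl a' := fun b => by
      rcases h : π (Sum.inr b) with a | b'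
      · exact ⟨a, rfl⟩
      · obtain ⟨a', ha'⟩ := hα b'
        exact (excl (ha'.trans h.symm)).elim
    choose σ hσ using h1
    choose τ hτ using h2
    have iσ : Function.Injective σ := fun x y h =>
      Sum.inl_injective (π.injective (by rw [hσ, hσ, h]))
    have iτ : Function.Injective τ := fun x y h =>
      Sum.inr_injective (π.injective (by rw [hτ, hτ, h]))
    have sσ : Function.Surjective σ := fun b => by
      obtain ⟨a, ha⟩ := hα b
      exact ⟨a, Sum.inr_injective ((hσ a).symm.trans ha)⟩
    have sτ : Function.Surjective τ := fun a => by
      obtain ⟨b, hb⟩ := hβ a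
      exact ⟨b, Sum.inl_injective ((hτ b).symm.trans hb)⟩
    exact ⟨Equiv.ofBijective σ ⟨iσ, sσ⟩, Equiv.ofBijective τ ⟨iτ, sτ⟩, hσ, hτ⟩
  · obtain ⟨a', h1⟩ := hα (Classical.arbitrary β)
    obtain ⟨b', h2⟩ := hβ (Classical.arbitrary β)
    exact (excl (h1.trans h2.symm)).elim

/-- If an integral affine equivalence (a `GL(r+s, ℤ)` matrix plus a translation) maps
`Δ_a^κ` onto `Δ_b^{κ'}`, where `a, b` are nondecreasing nonnegative integer vectors and
`κ > σ₁(a) − s`, `κ' > σ₁(b) − s`, then `a = b` and `κ = κ'`. -/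
theorem stmt_11 (r s : ℕ) (hr : 1 ≤ r) (hs : 1 ≤ s)
    (a b : Fin r → ℕ) (ha : Monotone a) (hb : Monotone b)
    (κ κ' : ℝ) (hκ : (∑ i, (a i : ℝ)) - s < κ) (hκ' : (∑ i, (b i : ℝ)) - s < κ')
    (M : Matrix (Fin (r + s)) (Fin (r + s)) ℤ) (hM : M.det = 1 ∨ M.det = -1)
    (v : Fin (r + s) → ℝ)
    (h : (fun u => (M.map fun z : ℤ => (z : ℝ)).mulVec u + v) '' Delta r s a κ =
      Delta r s b κ') :
    a = b ∧ κ = κ' := by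
  have hMu : IsUnit M.det := Int.isUnit_iff.2 hM
  rw [Delta_eq_setOf_slack_nonneg, Delta_eq_setOf_slack_nonneg] at h
  obtain ⟨π, hπ⟩ := exists_perm_affineForm_eq (facetNormal r s a) (facetNormal r s b)
    (facetConst r s κ) (facetConst r s κ') (exists_facetNormal_dotProduct_eq_one a hr hs)
    (exists_facetNormal_dotProduct_eq_one b hr hs) (exists_facet_point a κ hr hs hκ) M hMu v h
  set T : (Fin (r + s) → ℝ) → Fin (r + s) → ℝ :=
    fun u => (M.map fun z : ℤ => (z : ℝ)).mulVec u + v with hT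
  replace hπ : ∀ k u, slack r s b κ' (π k) (T u) = slack r s a κ k u := hπ
  have hTsurj : Function.Surjective T := fun u =>
    ⟨(M⁻¹.map fun z : ℤ => (z : ℝ)) *ᵥ (u - v), by
      simp only [hT, map_intCast_mulVec_mulVec (M.mul_nonsing_inv hMu), sub_add_cancel]⟩
  have hvertex : ∀ e f, ∃ u, (∀ k, 0 ≤ slack r s a κ k u) ∧
      ∀ k, π k ≠ Sum.inl e → π k ≠ Sum.inr f → slack r s a κ k u = 0 := fun e f => by
    obtain ⟨p, hp0, hp1, hp2⟩ := exists_vertex b κ' hκ' e f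
    obtain ⟨u, rfl⟩ := hTsurj p
    refine ⟨u, fun k => hπ k u ▸ hp0 (π k), fun k he hf => ?_⟩
    rw [← hπ]
    rcases hk : π k with e' | f'
    · rw [hp1, if_neg fun h => he (by rw [hk, h])]
    · exact hp2 f' fun h => hf (by rw [hk, h])
  have hE : (∀ e, ∃ e', π (Sum.inl e') = Sum.inl e) ∨ ∀ f, ∃ e', π (Sum.inl e') = Sum.inr f := by
    by_contra! hcon
    obtain ⟨⟨e, he⟩, f, hf⟩ := hcon
    obtain ⟨u, -, hu⟩ := hvertex e f
    exact not_forall_slack_inl_eq_zero a κ u fun e' => hu _ (he e') (hf e')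
  have hF : (∀ e, ∃ f', π (Sum.inr f') = Sum.inl e) ∨ ∀ f, ∃ f', π (Sum.inr f') = Sum.inr f := by
    by_contra! hcon
    obtain ⟨⟨e, he⟩, f, hf⟩ := hcon
    obtain ⟨u, hu0, hu⟩ := hvertex e f
    exact not_forall_slack_inr_eq_zero a κ u hκ hu0 fun f' => hu _ (he f') (hf f')
  suffices hab : a = b ∧ κ + s - ∑ i, (a i : ℝ) = κ' + s - ∑ i, (b i : ℝ) by
    obtain ⟨rfl, hκκ'⟩ := hab
    exact ⟨rfl, by linarith⟩
  rcases perm_sum_preserves_or_swaps π hE hF with ⟨σ, τ, hσ, hτ⟩ | ⟨σ, τ, hσ, hτ⟩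
  · have key : ∀ e, (κ + s - ∑ i, (a i : ℝ)) + extendZero a e * (r + 1) =
        (κ' + s - ∑ i, (b i : ℝ)) + extendZero b (σ e) * (r + 1) := fun e => by
      obtain ⟨u, -, hu, -⟩ := exists_vertex a κ hκ e none
      have h1 := sum_slack_inr (s := s) a κ u
      have h2 := sum_slack_inr (s := s) b κ' (T u)
      rw [← Equiv.sum_comp τ, ← Equiv.sum_comp σ] at h2
      simp only [← hσ, ← hτ, hπ] at h2
      rw [h1] at h2
      simpa [hu] using h2
    have hr1 : (0 : ℝ) < r + 1 := by positivity
    have hC : κ + s - ∑ i, (a i : ℝ) = κ' + s - ∑ i, (b i : ℝ) := by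
      have h1 := key none
      have h2 := key (σ.symm none)
      have h3 := mul_nonneg (extendZero_nonneg b (σ none)) hr1.le
      have h4 := mul_nonneg (extendZero_nonneg a (σ.symm none)) hr1.le
      rw [Equiv.apply_symm_apply] at h2
      simp only [extendZero, Option.elim_none, zero_mul] at h1 h2 h3 h4
      linarith
    refine ⟨eq_of_extendZero_comp_eq ha hb σ fun e => ?_, hC⟩
    have := key e
    rw [hC] at this
    exact mul_right_cancel₀ hr1.ne' (add_left_cancel this)
  · obtain ⟨h1, h2⟩ := eq_zero_of_sum_slack_inr_const (C := r + 1) a κ hκ fun u => by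
      rw [← sum_slack_inl (s := s) b κ' (T u), ← Equiv.sum_comp τ]
      simp only [← hτ, hπ]
    obtain ⟨h3, h4⟩ := eq_zero_of_sum_slack_inr_const (C := r + 1) b κ' hκ' fun p => by
      obtain ⟨u, rfl⟩ := hTsurj p
      rw [← sum_slack_inl (s := s) a κ u, ← Equiv.sum_comp σ]
      simp only [← hσ, hπ]
    exact ⟨h2.trans h4.symm, h1.trans h3.symm⟩
end

section
/- Let s ≥ 2 be an integer and let a, b be nonnegative integers. Let R = ℤ[x,y]/(x^{s+1}, y·(y − b·x)), and write x̄, ȳ for the images of x, y in R. Suppose there exist integers A, B, C, D with A·D − B·C = ±1 such that in R one has (A·x̄ + B·ȳ)^{s+1} = 0 and (C·x̄ + D·ȳ)·((C·x̄ + D·ȳ) − a·(A·x̄ + B·ȳ)) = 0. Then b divides a. -/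
open MvPolynomial in
/-- A binary quadratic form lying in the ideal `(x ^ (s + 1), y * (y - b * x))` of `ℤ[x, y]`,
where `2 ≤ s`, is an integer multiple of `y * (y - b * x)`. -/
theorem quadratic_form_coeffs_of_mem_span {s : ℕ} (hs : 2 ≤ s) {b p q r : ℤ}
    (h : (C p * X 0 * X 0 + C q * X 0 * X 1 + C r * X 1 * X 1 : MvPolynomial (Fin 2) ℤ) ∈
      Ideal.span {X 0 ^ (s + 1), X 1 * (X 1 - C b * X 0)}) :
    p = 0 ∧ q = -(b * r) := by
  obtain ⟨f, g, hfg⟩ := Ideal.mem_span_pair.mp h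
  obtain ⟨k, rfl⟩ := Nat.exists_eq_add_of_le hs
  have key : (C p * X 0 * X 0 + C q * X 0 * X 1 + C r * X 1 * X 1 : MvPolynomial (Fin 2) ℤ) =
      f * X 0 ^ k * X 0 * X 0 * X 0 + g * X 1 * X 1 - C b * (g * X 0 * X 1) := by
    rw [← hfg]; ring
  have h0 := congrArg (coeff (Finsupp.single 0 1 + Finsupp.single 0 1)) key
  have h1 := congrArg (coeff (Finsupp.single 0 1 + Finsupp.single 1 1)) key
  have h2 := congrArg (coeff (Finsupp.single 1 1 + Finsupp.single 1 1)) key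
  simp [coeff_mul_X', coeff_C_mul, -eq_intCast] at h0 h1 h2
  exact ⟨h0, by rw [h1, h2]⟩


/-- If in `R = ℤ[x,y]/(x^{s+1}, y·(y − b·x))` with `s ≥ 2` there are integers
`A,B,C,D` with `AD − BC = ±1` such that `(A·x̄ + B·ȳ)^{s+1} = 0` and
`(C·x̄ + D·ȳ)·((C·x̄ + D·ȳ) − a·(A·x̄ + B·ȳ)) = 0`, then `b` divides `a`. -/
theorem stmt_13 (s : ℕ) (hs : 2 ≤ s) (a b : ℕ) (A B C D : ℤ)
    (hdet : A * D - B * C = 1 ∨ A * D - B * C = -1)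
    (I : Ideal (MvPolynomial (Fin 2) ℤ))
    (hI : I = Ideal.span {MvPolynomial.X 0 ^ (s + 1),
      MvPolynomial.X 1 * (MvPolynomial.X 1 - MvPolynomial.C (b : ℤ) * MvPolynomial.X 0)})
    (h1 : ((A : MvPolynomial (Fin 2) ℤ ⧸ I) * Ideal.Quotient.mk I (MvPolynomial.X 0) +
        (B : MvPolynomial (Fin 2) ℤ ⧸ I) * Ideal.Quotient.mk I (MvPolynomial.X 1)) ^
          (s + 1) = 0)
    (h2 : ((C : MvPolynomial (Fin 2) ℤ ⧸ I) * Ideal.Quotient.mk I (MvPolynomial.X 0) +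
        (D : MvPolynomial (Fin 2) ℤ ⧸ I) * Ideal.Quotient.mk I (MvPolynomial.X 1)) *
      (((C : MvPolynomial (Fin 2) ℤ ⧸ I) * Ideal.Quotient.mk I (MvPolynomial.X 0) +
          (D : MvPolynomial (Fin 2) ℤ ⧸ I) * Ideal.Quotient.mk I (MvPolynomial.X 1)) -
        (a : MvPolynomial (Fin 2) ℤ ⧸ I) *
          ((A : MvPolynomial (Fin 2) ℤ ⧸ I) * Ideal.Quotient.mk I (MvPolynomial.X 0) +
            (B : MvPolynomial (Fin 2) ℤ ⧸ I) *
              Ideal.Quotient.mk I (MvPolynomial.X 1))) = 0) :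
    b ∣ a := by
  have hmem : (MvPolynomial.C (C * (C - a * A)) * MvPolynomial.X 0 * MvPolynomial.X 0 +
      MvPolynomial.C (2 * C * D - a * (A * D + B * C)) * MvPolynomial.X 0 * MvPolynomial.X 1 +
      MvPolynomial.C (D * (D - a * B)) * MvPolynomial.X 1 * MvPolynomial.X 1 :
        MvPolynomial (Fin 2) ℤ) ∈ I := by
    rw [← Ideal.Quotient.eq_zero_iff_mem, ← h2]
    simp only [eq_intCast, map_add, map_mul, map_intCast]
    push_cast
    ring
  rw [hI] at hmem
  obtain ⟨hp, hq⟩ := quadratic_form_coeffs_of_mem_span hs hmem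
  have hdvd : (b : ℤ) ∣ a * (A * D - B * C) := by
    rcases mul_eq_zero.mp hp with hC | hC
    · exact ⟨D * (D - a * B), by subst hC; linear_combination -hq⟩
    · refine ⟨-(D * (D - a * B)), ?_⟩
      linear_combination hq + (-2 * D) * hC
  rcases hdet with h | h <;> rw [h] at hdvd <;> exact_mod_cast (by simpa using hdvd : (b : ℤ) ∣ a)
end
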